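/- Let P ∈ C₊ be nonempty. Then the complement R̄₊ⁿ \ P is bounded (i.e. P is cobounded, P ∈ CC₊) if and only if there exists a vector s* ∈ R₋ⁿ (all coordinates strictly negative) such that P° ⊆ s* + R̄₋ⁿ. -/

import Mathlib

open Set MeasureTheory Pointwise

noncomputable section

abbrev En (n : ℕ) := EuclideanSpace ℝ (Fin n)

/-- Standard inner product on ℝⁿ. -/
def dotp {n : ℕ} (x y : En n) : ℝ := ∑ i, x i * y i

/-- Closed positive orthant R̄₊ⁿ. -/
def posOrthantCl (n : ℕ) : Set (En n) := {x | ∀ i, 0 ≤ x i}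
/-- Open positive orthant R₊ⁿ. -/
def posOrthantOp (n : ℕ) : Set (En n) := {x | ∀ i, 0 < x i}
/-- Closed negative orthant R̄₋ⁿ. -/
def negOrthantCl (n : ℕ) : Set (En n) := {x | ∀ i, x i ≤ 0}
/-- Open negative orthant R₋ⁿ. -/
def negOrthantOp (n : ℕ) : Set (En n) := {x | ∀ i, x i < 0}

/-- Copolar A° = {x : ⟨x,y⟩ ≤ −1 for all y ∈ A}. -/
def copolar {n : ℕ} (A : Set (En n)) : Set (En n) := {x | ∀ y ∈ A, dotp x y ≤ -1}

/-- Membership in C₊: closed convex subset of R̄₊ⁿ with A + R₊ⁿ ⊆ A. -/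
def memCplus {n : ℕ} (A : Set (En n)) : Prop :=
  IsClosed A ∧ Convex ℝ A ∧ A ⊆ posOrthantCl n ∧ A + posOrthantOp n ⊆ A

/-- Membership in C₋: closed convex subset of R̄₋ⁿ with A + R₋ⁿ ⊆ A. -/
def memCminus {n : ℕ} (A : Set (En n)) : Prop :=
  IsClosed A ∧ Convex ℝ A ∧ A ⊆ negOrthantCl n ∧ A + negOrthantOp n ⊆ A

/-- Membership in CC₊: member of C₊ with bounded complement in R̄₊ⁿ. -/
def memCCplus {n : ℕ} (P : Set (En n)) : Prop :=
  memCplus P ∧ Bornology.IsBounded (posOrthantCl n \ P)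

/-- Membership in UC₋: nonempty member of C₋ contained in s* + R̄₋ⁿ for some s* ∈ R₋ⁿ. -/
def memUCminus {n : ℕ} (L : Set (En n)) : Prop :=
  L.Nonempty ∧ memCminus L ∧ ∃ s ∈ negOrthantOp n, L ⊆ s +ᵥ negOrthantCl n

/-- Support function of a set, with values in EReal. -/
def suppFn {n : ℕ} (A : Set (En n)) (x : En n) : EReal := ⨆ y ∈ A, ((dotp x y : ℝ) : EReal)

/-- Legendre transform of an EReal-valued function. -/
def legendre {n : ℕ} (f : En n → EReal) (y : En n) : EReal :=
  ⨆ x, ((dotp x y : ℝ) : EReal) - f x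
theorem dotp_eq_inner {n : ℕ} (x y : En n) : dotp x y = inner ℝ x y := by
  simp [dotp, PiLp.inner_apply, mul_comm]

theorem dotp_single {n : ℕ} (x : En n) (i : Fin n) (t : ℝ) :
    dotp x (EuclideanSpace.single i t) = x i * t := by
  simp [dotp]

theorem dotp_add_right {n : ℕ} (x y z : En n) : dotp x (y + z) = dotp x y + dotp x z := by
  simp only [dotp_eq_inner, inner_add_right]

theorem dotp_smul_left {n : ℕ} (c : ℝ) (x y : En n) : dotp (c • x) y = c * dotp x y := by
  simp only [dotp_eq_inner, real_inner_smul_left]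

theorem mem_vadd_negOrthantCl_iff {n : ℕ} (s x : En n) :
    x ∈ s +ᵥ negOrthantCl n ↔ ∀ i, x i ≤ s i := by
  simp [Set.mem_vadd_set_iff_neg_vadd_mem, negOrthantCl]

/-- A point outside a closed convex set is strictly separated from it by a vector. -/
theorem exists_dotp_separation {n : ℕ} {P : Set (En n)} (hcl : IsClosed P) (hcv : Convex ℝ P)
    {y : En n} (hy : y ∉ P) : ∃ (a : En n) (u : ℝ), dotp a y < u ∧ ∀ p ∈ P, u < dotp a p := by
  obtain ⟨f, u, hfy, hfP⟩ := geometric_hahn_banach_point_closed hcv hcl hy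
  refine ⟨(InnerProductSpace.toDual ℝ (En n)).symm f, u, ?_, fun p hp => ?_⟩
  · simpa [dotp_eq_inner] using hfy
  · simpa [dotp_eq_inner] using hfP p hp

/-- A linear functional bounded below on a nonempty complete set has nonnegative coefficients. -/
theorem nonneg_of_bddBelow_dotp {n : ℕ} {P : Set (En n)} (hadd : P + posOrthantOp n ⊆ P)
    (hne : P.Nonempty) {a : En n} {u : ℝ} (ha : ∀ p ∈ P, u < dotp a p) (i : Fin n) : 0 ≤ a i := by
  obtain ⟨p, hp⟩ := hne
  by_contra! hi
  set e : En n := WithLp.toLp 2 fun _ => 1 with he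
  have key : ∀ M : ℝ, 0 ≤ M → u < dotp a p + (dotp a e + a i * M) := by
    intro M hM
    rw [← dotp_single, ← dotp_add_right, ← dotp_add_right]
    refine ha _ (hadd (Set.add_mem_add hp fun j => ?_))
    by_cases h : j = i
    · subst h
      simpa [he] using add_pos_of_pos_of_nonneg one_pos hM
    · simp [he, h]
  have h0 := key 0 le_rfl
  have h1 := key ((u - (dotp a p + dotp a e)) / a i)
    (div_nonneg_of_nonpos (by linarith) hi.le)
  rw [mul_div_cancel₀ _ hi.ne] at h1
  linarith

/-- If the copolar lies below `s`, then `P` contains every point of the orthant with a coordinate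
at least `-(s j)⁻¹`. -/
theorem mem_of_copolar_le {n : ℕ} {P : Set (En n)} (hP : memCplus P) (hne : P.Nonempty)
    {s : En n} (hs : s ∈ negOrthantOp n) (h : ∀ x ∈ copolar P, ∀ i, x i ≤ s i)
    {y : En n} (hy : y ∈ posOrthantCl n) {j : Fin n} (hj : -(s j)⁻¹ ≤ y j) : y ∈ P := by
  obtain ⟨hcl, hcv, -, hadd⟩ := hP
  by_contra hyP
  obtain ⟨a, u, hay, haP⟩ := exists_dotp_separation hcl hcv hyP
  have ha := nonneg_of_bddBelow_dotp hadd hne haP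
  have hterm : ∀ i, 0 ≤ a i * y i := fun i => mul_nonneg (ha i) (hy i)
  have hu : 0 < u := (Finset.sum_nonneg fun i _ => hterm i).trans_lt hay
  have hx : (-u⁻¹) • a ∈ copolar P := by
    intro p hp
    rw [dotp_smul_left]
    have := mul_le_mul_of_nonneg_left (haP p hp).le (inv_pos.2 hu).le
    rw [inv_mul_cancel₀ hu.ne'] at this
    linarith
  have hxj : -u⁻¹ * a j ≤ s j := h _ hx j
  have haj : u * -s j ≤ a j := by
    have := mul_le_mul_of_nonneg_left hxj hu.le
    rw [← mul_assoc, mul_neg, mul_inv_cancel₀ hu.ne'] at this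
    linarith
  have hsj : s j < 0 := hs j
  have h1 : a j * y j ≤ dotp a y :=
    Finset.single_le_sum (f := fun i => a i * y i) (fun i _ => hterm i) (Finset.mem_univ j)
  have h2 : u * -s j * -(s j)⁻¹ ≤ a j * y j :=
    mul_le_mul haj hj (neg_nonneg.2 (inv_nonpos.2 hsj.le)) (ha j)
  have h3 : u * -s j * -(s j)⁻¹ = u := by
    rw [mul_assoc, neg_mul_neg, mul_inv_cancel₀ hsj.ne, mul_one]
  linarith

/-- For nonempty P ∈ C₊, the complement R̄₊ⁿ \ P is bounded (P ∈ CC₊)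
iff P° ⊆ s* + R̄₋ⁿ for some s* with all coordinates strictly negative. -/
theorem isBounded_compl_iff_copolar_subset_translate (n : ℕ) (hn : 1 ≤ n)
    (P : Set (En n)) (hP : memCplus P) (hne : P.Nonempty) :
    Bornology.IsBounded (posOrthantCl n \ P) ↔
      ∃ s ∈ negOrthantOp n, copolar P ⊆ s +ᵥ negOrthantCl n := by
  constructor
  · intro hb
    obtain ⟨R, hR⟩ := isBounded_iff_forall_norm_le.1 hb
    set t : ℝ := |R| + 1 with ht
    have htpos : 0 < t := by positivity
    refine ⟨WithLp.toLp 2 fun _ => -t⁻¹, fun i => by simpa using htpos, fun x hx => ?_⟩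
    rw [mem_vadd_negOrthantCl_iff]
    intro i
    have hmem : EuclideanSpace.single i t ∈ P := by
      by_contra hnot
      have horth : (EuclideanSpace.single i t : En n) ∈ posOrthantCl n := by
        intro j
        by_cases h : j = i
        · subst h
          simpa using htpos.le
        · simp [h]
      have hnorm := hR _ ⟨horth, hnot⟩
      rw [PiLp.norm_single, Real.norm_of_nonneg htpos.le] at hnorm
      linarith [le_abs_self R]
    have hxi := hx _ hmem
    rw [dotp_single, ← le_div_iff₀ htpos] at hxi
    simpa [neg_div] using hxi
  · rintro ⟨s, hs, hsub⟩
    refine isBounded_iff_forall_norm_le.2 ⟨√(∑ i, (-(s i)⁻¹) ^ 2), fun y hy => ?_⟩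
    rw [EuclideanSpace.norm_eq]
    gcongr with i
    rw [Real.norm_of_nonneg (hy.1 i)]
    by_contra! hlt
    exact hy.2 (mem_of_copolar_le hP hne hs
      (fun x hx => (mem_vadd_negOrthantCl_iff s x).1 (hsub hx)) hy.1 hlt.le)
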